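/- Let n ≥ 1 be an integer, μ > 0 a real number, and F(θ) = √(∑_{k=0}^{n−1} (cos θ)^{2k}). Consider the vector field X on ℝ³ given by X(θ,T,Q) = ( −6μ·F(θ)·((T−1)·cos θ + T)/n + 3Q(T−1)·F(θ)²·sin(2θ)/(2n), 3Q(T−1)²·T·(1−(cos θ)^{2n})/n, −3(Q²−1)(T−1)(1−(cos θ)^{2n}) ). Then the point (θ,T,Q) = (0, 1/2, 1) is an equilibrium of X and it is unstable (it is not Lyapunov stable). -/

import Mathlib

open Real Filter

noncomputable section

/-- Lyapunov stability of the equilibrium `p` of the vector field `X` on the domain `D`. -/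
def LyapunovStable {E : Type*} [NormedAddCommGroup E] [NormedSpace ℝ E]
    (X : E → E) (D : Set E) (p : E) : Prop :=
  ∀ ε > 0, ∃ δ > 0, ∀ γ : ℝ → E,
    (∀ t : ℝ, 0 ≤ t → γ t ∈ D) →
    (∀ t : ℝ, 0 ≤ t → HasDerivAt γ (X (γ t)) t) →
    ‖γ 0 - p‖ < δ → ∀ t : ℝ, 0 ≤ t → ‖γ t - p‖ < ε

/-- `F θ = √(∑_{k=0}^{n-1} (cos θ)^{2k})`. -/
def F (n : ℕ) (θ : ℝ) : ℝ :=
  Real.sqrt (∑ k ∈ Finset.range n, Real.cos θ ^ (2 * k))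

/-- The unwrapped vector field (flat, Λ ≠ 0, detailed balance, E-model potential);
coordinates `(θ, T, Q)`. -/
def X10 (n : ℕ) (μ : ℝ) (p : ℝ × ℝ × ℝ) : ℝ × ℝ × ℝ :=
  (-6 * μ * F n p.1 * ((p.2.1 - 1) * Real.cos p.1 + p.2.1) / n
      + 3 * p.2.2 * (p.2.1 - 1) * F n p.1 ^ 2 * Real.sin (2 * p.1) / (2 * n),
   3 * p.2.2 * (p.2.1 - 1) ^ 2 * p.2.1 * (1 - Real.cos p.1 ^ (2 * n)) / n,
   -3 * (p.2.2 ^ 2 - 1) * (p.2.1 - 1) * (1 - Real.cos p.1 ^ (2 * n)))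

open Manifold in
/-- A bounded `C¹` vector field on a proper space has a global integral curve through each
point. -/
theorem exists_global_integralCurve_of_bounded {E : Type*} [NormedAddCommGroup E]
    [NormedSpace ℝ E] [ProperSpace E] {v : E → E} (hv : ContDiff ℝ 1 v) {L : ℝ}
    (hL : ∀ x, ‖v x‖ ≤ L) (x : E) :
    ∃ γ : ℝ → E, γ 0 = x ∧ ∀ t, HasDerivAt γ (v (γ t)) t := by
  have hL0 : 0 ≤ L := (norm_nonneg _).trans (hL x)
  have hmfd := (exists_isMIntegralCurve_iff_exists_isMIntegralCurveOn_Ioo (I := 𝓘(ℝ, E))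
    (v := v) (contMDiff_vectorSpace_iff_contDiff.2 hv) x).2 fun a ↦ by
      rcases le_or_gt a 0 with ha | ha
      · refine ⟨fun _ ↦ x, rfl, fun t ht ↦ ?_⟩
        exact absurd (ht.1.trans ht.2) (by linarith)
      · obtain ⟨K, hK⟩ := hv.locallyLipschitz.locallyLipschitzOn.exists_lipschitzOnWith_of_compact
          (isCompact_closedBall x (L * a))
        have hpl : IsPicardLindelof (fun _ : ℝ ↦ v) (tmin := -a) (tmax := a)
            ⟨0, by linarith, ha.le⟩ x (L * a).toNNReal 0 L.toNNReal K :=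
          { lipschitzOnWith := fun t _ ↦ by
              rwa [Real.coe_toNNReal _ (mul_nonneg hL0 ha.le)]
            continuousOn := fun y _ ↦ continuousOn_const
            norm_le := fun t _ y _ ↦ by rw [Real.coe_toNNReal _ hL0]; exact hL y
            mul_max_le := by
              rw [Real.coe_toNNReal _ hL0, Real.coe_toNNReal _ (mul_nonneg hL0 ha.le)]
              simp }
        obtain ⟨γ, h0, hγ⟩ := hpl.exists_eq_forall_mem_Icc_hasDerivWithinAt₀
        refine ⟨γ, h0, fun t ht ↦ ?_⟩
        exact ((hγ t (Set.Ioo_subset_Icc_self ht)).mono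
          Set.Ioo_subset_Icc_self).hasFDerivWithinAt.hasMFDerivWithinAt
  obtain ⟨γ, h0, hγ⟩ := hmfd
  refine ⟨γ, h0, fun t ↦ ?_⟩
  have h : HasFDerivAt γ ((1 : ℝ →L[ℝ] ℝ).smulRight (v (γ t))) t := (hγ t).hasFDerivAt
  simpa using h.hasDerivAt

theorem one_le_sum_even_pow {n : ℕ} (hn : 1 ≤ n) (x : ℝ) :
    1 ≤ ∑ k ∈ Finset.range n, x ^ (2 * k) := by
  have := Finset.single_le_sum (f := fun k ↦ x ^ (2 * k)) (s := Finset.range n)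
    (fun k _ ↦ by rw [pow_mul]; positivity) (Finset.mem_range.2 hn)
  simpa using this

theorem one_le_F {n : ℕ} (hn : 1 ≤ n) (θ : ℝ) : 1 ≤ F n θ :=
  Real.one_le_sqrt.2 (one_le_sum_even_pow hn _)

theorem F_sq_le (n : ℕ) (θ : ℝ) : F n θ ^ 2 ≤ n := by
  unfold F
  rw [Real.sq_sqrt (Finset.sum_nonneg fun k _ ↦ by rw [pow_mul]; positivity)]
  refine (Finset.sum_le_card_nsmul _ _ 1 fun k _ ↦ ?_).trans (by simp)
  rw [pow_mul]
  exact pow_le_one₀ (sq_nonneg _) (Real.cos_sq_le_one θ)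

theorem contDiff_F {n : ℕ} (hn : 1 ≤ n) : ContDiff ℝ 1 (F n) := by
  unfold F
  exact ContDiff.sqrt (by fun_prop) fun θ ↦
    (zero_lt_one.trans_le (one_le_sum_even_pow hn _)).ne'

/-- The restriction of `X10` to the invariant plane `Q = 1`, in the coordinates `(θ, u)` with
`T = (1 + sin u) / 2`. -/
def reducedField (n : ℕ) (μ : ℝ) (p : ℝ × ℝ) : ℝ × ℝ :=
  ((X10 n μ (p.1, (1 + Real.sin p.2) / 2, 1)).1,
    3 * (1 - Real.sin p.2) * Real.cos p.2 * (1 - Real.cos p.1 ^ (2 * n)) / (4 * n))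

theorem contDiff_reducedField {n : ℕ} (hn : 1 ≤ n) (μ : ℝ) :
    ContDiff ℝ 1 (reducedField n μ) := by
  have hF := contDiff_F hn
  unfold reducedField X10
  fun_prop

theorem exists_norm_reducedField_le (n : ℕ) (μ : ℝ) :
    ∃ L, ∀ p, ‖reducedField n μ p‖ ≤ L := by
  let G : ℝ × ℝ × ℝ × ℝ → ℝ × ℝ := fun q ↦
    (-6 * μ * Real.sqrt (∑ k ∈ Finset.range n, q.1 ^ (2 * k))
          * (((1 + q.2.2.2) / 2 - 1) * q.1 + (1 + q.2.2.2) / 2) / n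
        + 3 * 1 * ((1 + q.2.2.2) / 2 - 1) * Real.sqrt (∑ k ∈ Finset.range n, q.1 ^ (2 * k)) ^ 2
          * (2 * q.2.1 * q.1) / (2 * n),
      3 * (1 - q.2.2.2) * q.2.2.1 * (1 - q.1 ^ (2 * n)) / (4 * n))
  have hG : Continuous G := by fun_prop
  obtain ⟨L, hL⟩ := (isCompact_closedBall (0 : ℝ × ℝ × ℝ × ℝ) 1).exists_bound_of_continuousOn
    hG.continuousOn
  refine ⟨L, fun p ↦ ?_⟩
  have h := hL (Real.cos p.1, Real.sin p.1, Real.cos p.2, Real.sin p.2) (by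
    simp [Prod.norm_def, Real.abs_cos_le_one, Real.abs_sin_le_one])
  simpa only [G, reducedField, X10, F, Real.sin_two_mul] using h

/-- Every point of the plane `Q = 1` with `T ∈ [0, 1]` starts a global trajectory inside it. -/
theorem exists_trajectory {n : ℕ} (hn : 1 ≤ n) (μ θ₀ : ℝ) {T₀ : ℝ} (hT₀ : 0 ≤ T₀)
    (hT₁ : T₀ ≤ 1) :
    ∃ θ T : ℝ → ℝ, θ 0 = θ₀ ∧ T 0 = T₀ ∧
      ∀ t, HasDerivAt θ (X10 n μ (θ t, T t, 1)).1 t ∧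
        HasDerivAt T (X10 n μ (θ t, T t, 1)).2.1 t := by
  obtain ⟨L, hL⟩ := exists_norm_reducedField_le n μ
  obtain ⟨γ, h0, hγ⟩ := exists_global_integralCurve_of_bounded (contDiff_reducedField hn μ) hL
    (θ₀, Real.arcsin (2 * T₀ - 1))
  refine ⟨fun t ↦ (γ t).1, fun t ↦ (1 + Real.sin (γ t).2) / 2, by simp [h0], ?_, fun t ↦ ⟨?_, ?_⟩⟩
  · simp only [h0]
    rw [Real.sin_arcsin (by linarith) (by linarith)]
    ring
  · exact (hγ t).fst
  · have hn' : (n : ℝ) ≠ 0 := by positivity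
    have hu : HasDerivAt (fun t ↦ (γ t).2) (reducedField n μ (γ t)).2 t := (hγ t).snd
    refine ((hu.sin.const_add 1).div_const 2).congr_deriv ?_
    have hc := Real.sin_sq_add_cos_sq (γ t).2
    simp only [X10, reducedField]
    field_simp
    linear_combination 4 * (1 - Real.sin (γ t).2) * (1 - Real.cos (γ t).1 ^ (2 * n)) * hc

theorem sin_sq_le_one_sub_cos_pow {n : ℕ} (hn : 1 ≤ n) (θ : ℝ) :
    Real.sin θ ^ 2 ≤ 1 - Real.cos θ ^ (2 * n) := by
  have h : (Real.cos θ ^ 2) ^ n ≤ Real.cos θ ^ 2 :=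
    pow_le_of_le_one (sq_nonneg _) (Real.cos_sq_le_one θ) (by omega)
  rw [← pow_mul] at h
  linarith [Real.sin_sq_add_cos_sq θ]

theorem X10_fst_le {n : ℕ} (hn : 1 ≤ n) {μ : ℝ} (hμ : 0 < μ) {c : ℝ} (hc : 0 ≤ c) (θ : ℝ)
    {T : ℝ} (hT : 1 / 2 + c ≤ T) (hT₁ : T ≤ 1) :
    (X10 n μ (θ, T, 1)).1 ≤ -(12 * μ * c / n) + 3 * |Real.sin θ| := by
  have hn0 : (0 : ℝ) < n := by exact_mod_cast hn
  have hF := one_le_F hn θ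
  have hFn := F_sq_le n θ
  have hb : 2 * c ≤ (T - 1) * Real.cos θ + T := by
    nlinarith [Real.cos_le_one θ]
  have h1 : 2 * c ≤ F n θ * ((T - 1) * Real.cos θ + T) := by nlinarith
  have h1' : -6 * μ * F n θ * ((T - 1) * Real.cos θ + T) / n ≤ -(12 * μ * c / n) := by
    rw [← neg_div]
    gcongr
    nlinarith
  have h2 : 3 * 1 * (T - 1) * F n θ ^ 2 * Real.sin (2 * θ) / (2 * n) ≤ 3 * |Real.sin θ| := by
    rw [div_le_iff₀ (by positivity), Real.sin_two_mul]
    have hsc : -(Real.sin θ * Real.cos θ) ≤ |Real.sin θ| := by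
      refine (neg_le_abs _).trans ?_
      rw [abs_mul]
      exact mul_le_of_le_one_right (abs_nonneg _) (Real.abs_cos_le_one θ)
    have hk : 0 ≤ (1 - T) * F n θ ^ 2 := mul_nonneg (by linarith) (sq_nonneg _)
    have hk' : (1 - T) * F n θ ^ 2 ≤ n := by nlinarith [sq_nonneg (F n θ)]
    nlinarith [mul_le_mul_of_nonneg_left hsc hk,
      mul_le_mul_of_nonneg_right hk' (abs_nonneg (Real.sin θ))]
  exact add_le_add h1' h2

theorem le_X10_snd {n : ℕ} (hn : 1 ≤ n) (μ θ : ℝ) {T : ℝ} (hT : 1 / 4 ≤ T) (hT₁ : T ≤ 3 / 4) :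
    3 / (64 * n) * Real.sin θ ^ 2 ≤ (X10 n μ (θ, T, 1)).2.1 := by
  have hn0 : (0 : ℝ) < n := by exact_mod_cast hn
  have hs := sin_sq_le_one_sub_cos_pow hn θ
  have h : 1 / 64 ≤ (T - 1) ^ 2 * T := by
    nlinarith [mul_nonneg (sub_nonneg.2 hT₁) (sub_nonneg.2 hT)]
  have h' := mul_le_mul h hs (sq_nonneg _) (by positivity)
  simp only [X10]
  calc 3 / (64 * n) * Real.sin θ ^ 2 = 3 * (1 / 64 * Real.sin θ ^ 2) / n := by field_simp
    _ ≤ 3 * ((T - 1) ^ 2 * T * (1 - Real.cos θ ^ (2 * n))) / n := by gcongr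
    _ = _ := by ring

theorem stmt_10 (n : ℕ) (hn : 1 ≤ n) (μ : ℝ) (hμ : 0 < μ) :
    X10 n μ (0, 1 / 2, 1) = (0, 0, 0) ∧
      ¬ LyapunovStable (X10 n μ) (Set.univ : Set (ℝ × ℝ × ℝ)) (0, 1 / 2, 1) := by
  refine ⟨by norm_num [X10], fun hstab ↦ ?_⟩
  have hn0 : (0 : ℝ) < n := by exact_mod_cast hn
  obtain ⟨δ, hδ, hstab⟩ := hstab (1 / 4) (by norm_num)
  obtain ⟨c, hc, hcδ, hc2⟩ : ∃ c : ℝ, 0 < c ∧ c < δ ∧ c ≤ 1 / 2 :=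
    ⟨min (δ / 2) (1 / 2), by positivity, (min_le_left _ _).trans_lt (by linarith),
      min_le_right _ _⟩
  obtain ⟨θ, T, hθ0, hT0, hγ⟩ := exists_trajectory hn μ 0 (T₀ := 1 / 2 + c)
    (by linarith) (by linarith)
  have hclose := hstab (fun t ↦ (θ t, T t, 1)) (fun _ _ ↦ Set.mem_univ _)
    (fun t _ ↦ by
      refine ((hγ t).1.prodMk ((hγ t).2.prodMk (hasDerivAt_const t (1 : ℝ)))).congr_deriv ?_
      simp [X10])
    (by simpa [hθ0, hT0, Prod.norm_def, abs_of_pos hc, hδ] using hcδ)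
  have hbox : ∀ t, 0 ≤ t → |θ t| < 1 / 4 ∧ |T t - 1 / 2| < 1 / 4 := fun t ht ↦ by
    simpa [Prod.norm_def] using hclose t ht
  have hT' : ∀ t, 0 ≤ t → 3 / (64 * n) * Real.sin (θ t) ^ 2 ≤ (X10 n μ (θ t, T t, 1)).2.1 :=
    fun t ht ↦ by
      have := abs_lt.1 (hbox t ht).2
      exact le_X10_snd hn μ _ (by linarith) (by linarith)
  have hTmono : ∀ t, 0 ≤ t → 1 / 2 + c ≤ T t := fun t ht ↦ by
    have hmono : MonotoneOn T (Set.Ici 0) := by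
      refine monotoneOn_of_hasDerivWithinAt_nonneg (convex_Ici 0)
        (fun s _ ↦ (hγ s).2.continuousAt.continuousWithinAt)
        (fun s _ ↦ (hγ s).2.hasDerivWithinAt) fun s hs ↦ ?_
      exact le_trans (by positivity) (hT' s (interior_subset hs))
    exact hT0 ▸ hmono Set.self_mem_Ici ht ht
  set A : ℝ := 6 * μ * c / n with hA
  have hA0 : 0 < A := by positivity
  set K : ℝ := 48 * n / A with hK
  have hK0 : 0 < K := by positivity
  -- `θ - K T` decreases at least at rate `A`, contradicting boundedness.
  have hdecay : AntitoneOn (fun t ↦ θ t - K * T t + A * t) (Set.Ici 0) := by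
    refine antitoneOn_of_hasDerivWithinAt_nonpos (convex_Ici 0)
      (f' := fun t ↦ (X10 n μ (θ t, T t, 1)).1 - K * (X10 n μ (θ t, T t, 1)).2.1 + A * 1)
      (fun s _ ↦ ?_) (fun s _ ↦ ?_) fun s hs ↦ ?_
    · have h1 := (hγ s).1.continuousAt
      have h2 := (hγ s).2.continuousAt
      exact ContinuousAt.continuousWithinAt (by fun_prop)
    · exact (((hγ s).1.sub ((hγ s).2.const_mul K)).add
        ((hasDerivAt_id s).const_mul A)).hasDerivWithinAt
    · have hs0 : 0 ≤ s := interior_subset hs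
      have h1 := X10_fst_le hn hμ hc.le (θ s) (hTmono s hs0)
        (by linarith [(abs_lt.1 (hbox s hs0).2).2])
      have h2 := mul_le_mul_of_nonneg_left (hT' s hs0) hK0.le
      have h3 : K * (3 / (64 * n) * Real.sin (θ s) ^ 2) = 9 / (4 * A) * |Real.sin (θ s)| ^ 2 := by
        rw [sq_abs, hK]
        field_simp
        ring
      have h4 : 3 * |Real.sin (θ s)| ≤ A + 9 / (4 * A) * |Real.sin (θ s)| ^ 2 := by
        have : A + 9 / (4 * A) * |Real.sin (θ s)| ^ 2 - 3 * |Real.sin (θ s)|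
            = (2 * A - 3 * |Real.sin (θ s)|) ^ 2 / (4 * A) := by
          field_simp
          ring
        have : 0 ≤ (2 * A - 3 * |Real.sin (θ s)|) ^ 2 / (4 * A) := by positivity
        linarith
      have h5 : 12 * μ * c / n = 2 * A := by rw [hA]; ring
      linarith
  have ht0 : 0 ≤ (1 + K) / A := by positivity
  have hle := hdecay Set.self_mem_Ici ht0 ht0
  simp only [hθ0, hT0, mul_div_cancel₀ _ hA0.ne'] at hle
  have h1 := abs_lt.1 (hbox _ ht0).1
  have h2 := abs_lt.1 (hbox _ ht0).2
  nlinarith
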